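/- Let a₁, a₂, a₃ be real numbers. With J₁ = x₂p₃ − x₃p₂, J₂ = x₃p₁ − x₁p₃, J₃ = x₁p₂ − x₂p₁, define T = (a₁J₁² + a₂J₂² + a₃J₃²) − (a₁x₁² + a₂x₂² + a₃x₃²)(J₁² + J₂² + J₃²) and K = (a₁x₁J₁ + a₂x₂J₂ + a₃x₃J₃)²·(J₁² + J₂² + J₃²). Then {T, K}_S = 0 at every point of the constraint surface T*S² (where x₁²+x₂²+x₃² = 1 and x₁p₁+x₂p₂+x₃p₃ = 0). -/

import Mathlib

noncomputable section

/-- Phase space T*ℝ³ = ℝ³ × ℝ³ with coordinates (x, p). -/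
abbrev Phase : Type := (Fin 3 → ℝ) × (Fin 3 → ℝ)

/-- Canonical Poisson bracket on ℝ³ × ℝ³:
{f,g} = Σᵢ (∂f/∂xᵢ ∂g/∂pᵢ − ∂f/∂pᵢ ∂g/∂xᵢ). -/
noncomputable def pb (f g : Phase → ℝ) (z : Phase) : ℝ :=
  ∑ i : Fin 3,
    (fderiv ℝ f z (Pi.single i 1, 0) * fderiv ℝ g z (0, Pi.single i 1) -
     fderiv ℝ f z (0, Pi.single i 1) * fderiv ℝ g z (Pi.single i 1, 0))

/-- Dirac bracket associated with constraints F₁, F₂: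
{f,g}_D = {f,g} − ({F₁,f}{F₂,g} − {F₁,g}{F₂,f})/{F₁,F₂}. -/
noncomputable def dirac (F₁ F₂ f g : Phase → ℝ) (z : Phase) : ℝ :=
  pb f g z - (pb F₁ f z * pb F₂ g z - pb F₁ g z * pb F₂ f z) / pb F₁ F₂ z
/-- Sphere constraint F₁ = x₁² + x₂² + x₃² − 1. -/
def sphereF₁ : Phase → ℝ := fun z => z.1 0 ^ 2 + z.1 1 ^ 2 + z.1 2 ^ 2 - 1

/-- Sphere constraint F₂ = x₁p₁ + x₂p₂ + x₃p₃. -/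
def sphereF₂ : Phase → ℝ := fun z => z.1 0 * z.2 0 + z.1 1 * z.2 1 + z.1 2 * z.2 2

/-- Sphere Dirac bracket {·,·}_S. -/
noncomputable def diracS (f g : Phase → ℝ) (z : Phase) : ℝ :=
  dirac sphereF₁ sphereF₂ f g z

/-- Angular momentum J₁ = x₂p₃ − x₃p₂. -/
noncomputable def J1 : Phase → ℝ := fun z => z.1 1 * z.2 2 - z.1 2 * z.2 1
/-- Angular momentum J₂ = x₃p₁ − x₁p₃. -/
noncomputable def J2 : Phase → ℝ := fun z => z.1 2 * z.2 0 - z.1 0 * z.2 2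
/-- Angular momentum J₃ = x₁p₂ − x₂p₁. -/
noncomputable def J3 : Phase → ℝ := fun z => z.1 0 * z.2 1 - z.1 1 * z.2 0

theorem hasFDerivAt_position (i : Fin 3) (z : Phase) :
    HasFDerivAt (fun w : Phase => w.1 i)
      ((ContinuousLinearMap.proj i : (Fin 3 → ℝ) →L[ℝ] ℝ).comp
        (ContinuousLinearMap.fst ℝ (Fin 3 → ℝ) (Fin 3 → ℝ))) z :=
  ((ContinuousLinearMap.proj i : (Fin 3 → ℝ) →L[ℝ] ℝ).comp
    (ContinuousLinearMap.fst ℝ (Fin 3 → ℝ) (Fin 3 → ℝ))).hasFDerivAt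

theorem hasFDerivAt_momentum (i : Fin 3) (z : Phase) :
    HasFDerivAt (fun w : Phase => w.2 i)
      ((ContinuousLinearMap.proj i : (Fin 3 → ℝ) →L[ℝ] ℝ).comp
        (ContinuousLinearMap.snd ℝ (Fin 3 → ℝ) (Fin 3 → ℝ))) z :=
  ((ContinuousLinearMap.proj i : (Fin 3 → ℝ) →L[ℝ] ℝ).comp
    (ContinuousLinearMap.snd ℝ (Fin 3 → ℝ) (Fin 3 → ℝ))).hasFDerivAt

theorem fderiv_sphereF₁_apply (z v : Phase) :
    fderiv ℝ sphereF₁ z v = 2 * (z.1 0 * v.1 0 + z.1 1 * v.1 1 + z.1 2 * v.1 2) := by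
  have h := (((((hasFDerivAt_position 0 z).pow 2).add ((hasFDerivAt_position 1 z).pow 2)).add
    ((hasFDerivAt_position 2 z).pow 2)).sub_const 1)
  have h' : HasFDerivAt sphereF₁ _ z := h
  rw [h'.fderiv]
  simp
  ring

theorem differentiableAt_J1 (z : Phase) : DifferentiableAt ℝ J1 z := by
  unfold J1
  fun_prop

theorem fderiv_J1_apply (z v : Phase) :
    fderiv ℝ J1 z v = z.1 1 * v.2 2 + z.2 2 * v.1 1 - (z.1 2 * v.2 1 + z.2 1 * v.1 2) := by
  have h : HasFDerivAt J1 _ z :=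
    ((hasFDerivAt_position 1 z).mul (hasFDerivAt_momentum 2 z)).sub
      ((hasFDerivAt_position 2 z).mul (hasFDerivAt_momentum 1 z))
  rw [h.fderiv]
  simp

theorem differentiableAt_J2 (z : Phase) : DifferentiableAt ℝ J2 z := by
  unfold J2
  fun_prop

theorem fderiv_J2_apply (z v : Phase) :
    fderiv ℝ J2 z v = z.1 2 * v.2 0 + z.2 0 * v.1 2 - (z.1 0 * v.2 2 + z.2 2 * v.1 0) := by
  have h : HasFDerivAt J2 _ z :=
    ((hasFDerivAt_position 2 z).mul (hasFDerivAt_momentum 0 z)).sub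
      ((hasFDerivAt_position 0 z).mul (hasFDerivAt_momentum 2 z))
  rw [h.fderiv]
  simp

theorem differentiableAt_J3 (z : Phase) : DifferentiableAt ℝ J3 z := by
  unfold J3
  fun_prop

theorem fderiv_J3_apply (z v : Phase) :
    fderiv ℝ J3 z v = z.1 0 * v.2 1 + z.2 1 * v.1 0 - (z.1 1 * v.2 0 + z.2 0 * v.1 1) := by
  have h : HasFDerivAt J3 _ z :=
    ((hasFDerivAt_position 0 z).mul (hasFDerivAt_momentum 1 z)).sub
      ((hasFDerivAt_position 1 z).mul (hasFDerivAt_momentum 0 z))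
  rw [h.fderiv]
  simp

/-- The geodesic Hamiltonian `T`. -/
def geodesicT (a₁ a₂ a₃ : ℝ) : Phase → ℝ := fun w =>
  (a₁ * J1 w ^ 2 + a₂ * J2 w ^ 2 + a₃ * J3 w ^ 2) -
    (a₁ * w.1 0 ^ 2 + a₂ * w.1 1 ^ 2 + a₃ * w.1 2 ^ 2) *
      (J1 w ^ 2 + J2 w ^ 2 + J3 w ^ 2)

/-- The quartic invariant `K`. -/
def quarticK (a₁ a₂ a₃ : ℝ) : Phase → ℝ := fun w =>
  (a₁ * w.1 0 * J1 w + a₂ * w.1 1 * J2 w + a₃ * w.1 2 * J3 w) ^ 2 *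
    (J1 w ^ 2 + J2 w ^ 2 + J3 w ^ 2)

theorem fderiv_geodesicT_apply (a₁ a₂ a₃ : ℝ) (z v : Phase) :
    fderiv ℝ (geodesicT a₁ a₂ a₃) z v =
      2 * (a₁ * J1 z * fderiv ℝ J1 z v + a₂ * J2 z * fderiv ℝ J2 z v +
        a₃ * J3 z * fderiv ℝ J3 z v) -
      2 * (a₁ * z.1 0 * v.1 0 + a₂ * z.1 1 * v.1 1 + a₃ * z.1 2 * v.1 2) *
        (J1 z ^ 2 + J2 z ^ 2 + J3 z ^ 2) -
      2 * (a₁ * z.1 0 ^ 2 + a₂ * z.1 1 ^ 2 + a₃ * z.1 2 ^ 2) *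
        (J1 z * fderiv ℝ J1 z v + J2 z * fderiv ℝ J2 z v + J3 z * fderiv ℝ J3 z v) := by
  have d₁ := (differentiableAt_J1 z).hasFDerivAt.pow 2
  have d₂ := (differentiableAt_J2 z).hasFDerivAt.pow 2
  have d₃ := (differentiableAt_J3 z).hasFDerivAt.pow 2
  have x₁ := (hasFDerivAt_position 0 z).pow 2
  have x₂ := (hasFDerivAt_position 1 z).pow 2
  have x₃ := (hasFDerivAt_position 2 z).pow 2
  have h : HasFDerivAt (geodesicT a₁ a₂ a₃) _ z :=
    (((d₁.const_mul a₁).add (d₂.const_mul a₂)).add (d₃.const_mul a₃)).sub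
      ((((x₁.const_mul a₁).add (x₂.const_mul a₂)).add (x₃.const_mul a₃)).mul
        ((d₁.add d₂).add d₃))
  rw [h.fderiv]
  simp
  ring

theorem fderiv_quarticK_apply (a₁ a₂ a₃ : ℝ) (z v : Phase) :
    fderiv ℝ (quarticK a₁ a₂ a₃) z v =
      2 * (a₁ * z.1 0 * J1 z + a₂ * z.1 1 * J2 z + a₃ * z.1 2 * J3 z) *
        ((a₁ * (v.1 0 * J1 z + z.1 0 * fderiv ℝ J1 z v) +
          a₂ * (v.1 1 * J2 z + z.1 1 * fderiv ℝ J2 z v) +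
          a₃ * (v.1 2 * J3 z + z.1 2 * fderiv ℝ J3 z v)) *
            (J1 z ^ 2 + J2 z ^ 2 + J3 z ^ 2) +
          (a₁ * z.1 0 * J1 z + a₂ * z.1 1 * J2 z + a₃ * z.1 2 * J3 z) *
            (J1 z * fderiv ℝ J1 z v + J2 z * fderiv ℝ J2 z v + J3 z * fderiv ℝ J3 z v)) := by
  have d₁ := (differentiableAt_J1 z).hasFDerivAt
  have d₂ := (differentiableAt_J2 z).hasFDerivAt
  have d₃ := (differentiableAt_J3 z).hasFDerivAt
  have h : HasFDerivAt (quarticK a₁ a₂ a₃) _ z :=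
    ((((((hasFDerivAt_position 0 z).const_mul a₁).mul d₁).add
      (((hasFDerivAt_position 1 z).const_mul a₂).mul d₂)).add
      (((hasFDerivAt_position 2 z).const_mul a₃).mul d₃)).pow 2).mul
        (((d₁.pow 2).add (d₂.pow 2)).add (d₃.pow 2))
  rw [h.fderiv]
  simp
  ring

theorem pb_sphereF₁_geodesicT (a₁ a₂ a₃ : ℝ) (z : Phase) :
    pb sphereF₁ (geodesicT a₁ a₂ a₃) z = 0 := by
  simp [pb, Fin.sum_univ_three, fderiv_sphereF₁_apply, fderiv_geodesicT_apply,
    fderiv_J1_apply, fderiv_J2_apply, fderiv_J3_apply]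
  ring

theorem pb_sphereF₁_quarticK (a₁ a₂ a₃ : ℝ) (z : Phase) :
    pb sphereF₁ (quarticK a₁ a₂ a₃) z = 0 := by
  simp [pb, Fin.sum_univ_three, fderiv_sphereF₁_apply, fderiv_quarticK_apply,
    fderiv_J1_apply, fderiv_J2_apply, fderiv_J3_apply]
  ring

/-- The canonical bracket of two functions of `(x, J)` is the Lie–Poisson bracket of `e(3)`. -/
theorem pb_eq_lie_poisson {f g : Phase → ℝ} {z : Phase} {α β γ δ : Fin 3 → ℝ}
    (hf : ∀ v, fderiv ℝ f z v = α 0 * v.1 0 + α 1 * v.1 1 + α 2 * v.1 2 +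
      (β 0 * fderiv ℝ J1 z v + β 1 * fderiv ℝ J2 z v + β 2 * fderiv ℝ J3 z v))
    (hg : ∀ v, fderiv ℝ g z v = γ 0 * v.1 0 + γ 1 * v.1 1 + γ 2 * v.1 2 +
      (δ 0 * fderiv ℝ J1 z v + δ 1 * fderiv ℝ J2 z v + δ 2 * fderiv ℝ J3 z v)) :
    pb f g z =
      J1 z * (β 1 * δ 2 - β 2 * δ 1) + J2 z * (β 2 * δ 0 - β 0 * δ 2) +
        J3 z * (β 0 * δ 1 - β 1 * δ 0) +
      z.1 0 * (α 1 * δ 2 - α 2 * δ 1 + β 1 * γ 2 - β 2 * γ 1) +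
      z.1 1 * (α 2 * δ 0 - α 0 * δ 2 + β 2 * γ 0 - β 0 * γ 2) +
      z.1 2 * (α 0 * δ 1 - α 1 * δ 0 + β 0 * γ 1 - β 1 * γ 0) := by
  simp [pb, Fin.sum_univ_three, hf, hg, fderiv_J1_apply, fderiv_J2_apply, fderiv_J3_apply]
  simp only [J1, J2, J3]
  ring

/-- Where `|x| = 1`, expanding `A J × A x` along `x` in a triple product with `J`. -/
theorem angularMomentum_triple_product (a₁ a₂ a₃ : ℝ) {z : Phase}
    (h : z.1 0 ^ 2 + z.1 1 ^ 2 + z.1 2 ^ 2 = 1) :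
    a₂ * a₃ * J1 z * (J2 z * z.1 2 - J3 z * z.1 1) +
          a₃ * a₁ * J2 z * (J3 z * z.1 0 - J1 z * z.1 2) +
          a₁ * a₂ * J3 z * (J1 z * z.1 1 - J2 z * z.1 0) =
      (a₁ * z.1 0 ^ 2 + a₂ * z.1 1 ^ 2 + a₃ * z.1 2 ^ 2) *
        (z.1 0 * J2 z * J3 z * (a₃ - a₂) + z.1 1 * J3 z * J1 z * (a₁ - a₃) +
          z.1 2 * J1 z * J2 z * (a₂ - a₁)) +
      (a₁ * z.1 0 * J1 z + a₂ * z.1 1 * J2 z + a₃ * z.1 2 * J3 z) *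
        (J1 z * z.1 1 * z.1 2 * (a₃ - a₂) + J2 z * z.1 2 * z.1 0 * (a₁ - a₃) +
          J3 z * z.1 0 * z.1 1 * (a₂ - a₁)) := by
  rw [← sub_eq_zero]
  trans (a₂ * a₃ * J1 z * (J2 z * z.1 2 - J3 z * z.1 1) +
          a₃ * a₁ * J2 z * (J3 z * z.1 0 - J1 z * z.1 2) +
          a₁ * a₂ * J3 z * (J1 z * z.1 1 - J2 z * z.1 0)) *
        (1 - (z.1 0 ^ 2 + z.1 1 ^ 2 + z.1 2 ^ 2))
  · simp only [J1, J2, J3]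
    ring
  · rw [h, sub_self, mul_zero]

theorem pb_geodesicT_quarticK (a₁ a₂ a₃ : ℝ) {z : Phase}
    (h : z.1 0 ^ 2 + z.1 1 ^ 2 + z.1 2 ^ 2 = 1) :
    pb (geodesicT a₁ a₂ a₃) (quarticK a₁ a₂ a₃) z = 0 := by
  set N := J1 z ^ 2 + J2 z ^ 2 + J3 z ^ 2 with hN
  set L := a₁ * z.1 0 * J1 z + a₂ * z.1 1 * J2 z + a₃ * z.1 2 * J3 z with hL
  set s := a₁ * z.1 0 ^ 2 + a₂ * z.1 1 ^ 2 + a₃ * z.1 2 ^ 2 with hs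
  rw [pb_eq_lie_poisson
    (α := ![-2 * N * a₁ * z.1 0, -2 * N * a₂ * z.1 1, -2 * N * a₃ * z.1 2])
    (β := ![2 * (a₁ - s) * J1 z, 2 * (a₂ - s) * J2 z, 2 * (a₃ - s) * J3 z])
    (γ := ![2 * L * N * a₁ * J1 z, 2 * L * N * a₂ * J2 z, 2 * L * N * a₃ * J3 z])
    (δ := ![2 * L * (N * a₁ * z.1 0 + L * J1 z), 2 * L * (N * a₂ * z.1 1 + L * J2 z),
      2 * L * (N * a₃ * z.1 2 + L * J3 z)])
    (fun v => by rw [fderiv_geodesicT_apply, ← hN, ← hs]; simp; ring)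
    (fun v => by rw [fderiv_quarticK_apply, ← hN, ← hL]; simp; ring)]
  have key := angularMomentum_triple_product a₁ a₂ a₃ h
  rw [← hs, ← hL] at key
  simp only [Matrix.cons_val]
  linear_combination 4 * L * N * key

/-- the geodesic Hamiltonian T and the quartic invariant K on the
sphere are in involution with respect to the sphere Dirac bracket on T*S². -/
theorem quartic_metric_sphere_involution
    (a₁ a₂ a₃ : ℝ) (z : Phase)
    (h1 : z.1 0 ^ 2 + z.1 1 ^ 2 + z.1 2 ^ 2 = 1)
    (h2 : z.1 0 * z.2 0 + z.1 1 * z.2 1 + z.1 2 * z.2 2 = 0) :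
    diracS
      (fun w => (a₁ * J1 w ^ 2 + a₂ * J2 w ^ 2 + a₃ * J3 w ^ 2) -
        (a₁ * w.1 0 ^ 2 + a₂ * w.1 1 ^ 2 + a₃ * w.1 2 ^ 2) *
          (J1 w ^ 2 + J2 w ^ 2 + J3 w ^ 2))
      (fun w => (a₁ * w.1 0 * J1 w + a₂ * w.1 1 * J2 w + a₃ * w.1 2 * J3 w) ^ 2 *
        (J1 w ^ 2 + J2 w ^ 2 + J3 w ^ 2)) z = 0 := by
  change dirac sphereF₁ sphereF₂ (geodesicT a₁ a₂ a₃) (quarticK a₁ a₂ a₃) z = 0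
  simp [dirac, pb_sphereF₁_geodesicT, pb_sphereF₁_quarticK, pb_geodesicT_quarticK a₁ a₂ a₃ h1]
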